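/- arXiv:2404.09005 — 7 statements merged into one kernel-verified Lean document; each statement's English description precedes it below -/
import Mathlib

section
/- Let κ be a real number with 0 ≤ κ ≤ 1, and let α, m, T be natural numbers with T ≥ 1, m ≤ T and α ≤ T. Then, interpreting binomial coefficients as real numbers, ∑_{s=0}^{α} binom(α, s)·κ^s·(1−κ)^{α−s}·(binom(m, s)/binom(T, s)) ≤ ((1−κ) + κ·(m/T))^α. -/
theorem choose_div_choose_le_div_pow {m T : ℕ} (hm : m ≤ T) (s : ℕ) :
    (Nat.choose m s : ℝ) / (Nat.choose T s : ℝ) ≤ ((m : ℝ) / (T : ℝ)) ^ s := by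
  induction s with
  | zero => simp
  | succ s ih =>
    rcases le_or_gt m s with hs | hs
    · rw [Nat.choose_eq_zero_of_lt (Nat.lt_succ_of_le hs), Nat.cast_zero, zero_div]
      positivity
    · have hmT : (m : ℝ) ≤ T := by exact_mod_cast hm
      have hsm : (s : ℝ) < m := by exact_mod_cast hs
      have hs0 : (0 : ℝ) ≤ s := s.cast_nonneg
      have choose_succ (n : ℕ) (hn : s ≤ n) :
          (n.choose (s + 1) : ℝ) = n.choose s * ((n : ℝ) - s) / (s + 1) := by
        rw [eq_div_iff (by positivity), ← Nat.cast_sub hn]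
        exact_mod_cast Nat.choose_succ_right_eq n s
      have hratio : ((m : ℝ) - s) / (T - s) ≤ m / T := by
        rw [div_le_div_iff₀ (by linarith) (by linarith)]
        nlinarith
      rw [choose_succ m hs.le, choose_succ T (hs.le.trans hm),
        div_div_div_cancel_right₀ (by positivity), mul_div_mul_comm, pow_succ]
      exact mul_le_mul ih hratio (div_nonneg (by linarith) (by linarith)) (by positivity)

/-- For `κ ∈ [0,1]` and naturals `α, m, T` with `T ≥ 1`, `m ≤ T`,
`α ≤ T`: `∑_{s=0}^{α} C(α,s)·κ^s·(1−κ)^{α−s}·(C(m,s)/C(T,s)) ≤ ((1−κ)+κ·(m/T))^α`. -/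
theorem passing_prob_le (κ : ℝ) (hκ : κ ∈ Set.Icc (0:ℝ) 1)
    (α m T : ℕ) (hT : 1 ≤ T) (hm : m ≤ T) (hα : α ≤ T) :
    ∑ s ∈ Finset.range (α + 1),
        (Nat.choose α s : ℝ) * κ ^ s * (1 - κ) ^ (α - s) *
          ((Nat.choose m s : ℝ) / (Nat.choose T s : ℝ))
      ≤ ((1 - κ) + κ * ((m : ℝ) / (T : ℝ))) ^ α := by
  obtain ⟨hκ0, hκ1⟩ := hκ
  rw [add_comm (1 - κ), add_pow]
  refine Finset.sum_le_sum fun s _ => ?_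
  have h1κ : 0 ≤ 1 - κ := sub_nonneg.mpr hκ1
  calc _ ≤ (Nat.choose α s : ℝ) * κ ^ s * (1 - κ) ^ (α - s) * ((m : ℝ) / (T : ℝ)) ^ s :=
        mul_le_mul_of_nonneg_left (choose_div_choose_le_div_pow hm s) (by positivity)
    _ = _ := by rw [mul_pow]; ring
end

section
/- Let T and α be natural numbers with T ≥ 2 and α ≥ 2, let κ ∈ (0,1], β ∈ (0,1), λ ≥ 0 be real numbers, and let P : ℝ → ℝ be differentiable on [0,1] with derivative P', satisfying P(0) = 1, P(ρ) > 0 and −λ·P(ρ) ≤ P'(ρ) ≤ 0 for all ρ ∈ [0,1]. Define ū(ρ) = (1−κ+κρ)^α·P(ρ) − β·∫₀^ρ P(x) dx. Assume: (i) (1−κ)^α < P(1) − β·∫₀¹ P(x) dx; (ii) α ≥ 2(λ+β)/(βκ); and (iii) α ≥ 2·ln(T/β)/κ. Then ū(0) < ū(1), and for every ρ ∈ [1/T, 1), ū(ρ) < ū(1). -/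
/-- analytic core of the Main Theorem (0-IR-BIS). -/
theorem main_theorem_core (T α : ℕ) (hT : 2 ≤ T) (hα : 2 ≤ α)
    (κ β lam : ℝ) (hκ : κ ∈ Set.Ioc (0:ℝ) 1) (hβ : β ∈ Set.Ioo (0:ℝ) 1)
    (hlam : 0 ≤ lam)
    (P P' : ℝ → ℝ)
    (hP : ∀ ρ ∈ Set.Icc (0:ℝ) 1, HasDerivAt P (P' ρ) ρ)
    (hP0 : P 0 = 1)
    (hPpos : ∀ ρ ∈ Set.Icc (0:ℝ) 1, 0 < P ρ)
    (hhaz : ∀ ρ ∈ Set.Icc (0:ℝ) 1, -lam * P ρ ≤ P' ρ ∧ P' ρ ≤ 0)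
    (u : ℝ → ℝ)
    (hu : ∀ ρ, u ρ = (1 - κ + κ * ρ) ^ α * P ρ - β * ∫ x in (0:ℝ)..ρ, P x)
    (hIR : (1 - κ) ^ α < P 1 - β * ∫ x in (0:ℝ)..1, P x)
    (hα2 : 2 * (lam + β) / (β * κ) ≤ (α : ℝ))
    (hα3 : 2 * Real.log ((T : ℝ) / β) / κ ≤ (α : ℝ)) :
    u 0 < u 1 ∧ ∀ ρ ∈ Set.Ico (1 / (T : ℝ)) 1, u ρ < u 1 := by
  obtain ⟨hκ0, hκ1⟩ := hκ
  obtain ⟨hβ0, hβ1⟩ := hβ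
  have hTpos : (0 : ℝ) < T := by positivity
  have hT2 : (2 : ℝ) ≤ T := by exact_mod_cast hT
  have hcont : ContinuousOn P (Set.Icc 0 1) := fun x hx =>
    (hP x hx).continuousAt.continuousWithinAt
  have hanti : AntitoneOn P (Set.Icc 0 1) := by
    refine antitoneOn_of_deriv_nonpos (convex_Icc 0 1) hcont ?_ ?_
    · intro x hx
      exact (hP x (interior_subset hx)).differentiableAt.differentiableWithinAt
    · intro x hx
      rw [(hP x (interior_subset hx)).deriv]
      exact (hhaz x (interior_subset hx)).2
  have hint : ∀ ρ ∈ Set.Icc (0 : ℝ) 1, IntervalIntegrable P MeasureTheory.volume 0 ρ := by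
    intro ρ hρ
    refine ContinuousOn.intervalIntegrable_of_Icc hρ.1 (hcont.mono ?_)
    exact Set.Icc_subset_Icc_right hρ.2
  have hu1 : u 1 = P 1 - β * ∫ x in (0 : ℝ)..1, P x := by
    rw [hu]; simp
  have hu1lt : (1 - κ) ^ α < u 1 := hu1 ▸ hIR
  have hu1pos : 0 < u 1 := lt_of_le_of_lt (pow_nonneg (by linarith) α) hu1lt
  have hακ : 2 + 2 * lam / β ≤ α * κ := by
    rw [div_le_iff₀ (by positivity)] at hα2
    have : 2 + 2 * lam / β = 2 * (lam + β) / β := by field_simp; ring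
    rw [this, div_le_iff₀ hβ0]
    linarith
  have hlamβ : lam ≤ lam / β := le_div_self hlam hβ0 hβ1.le
  refine ⟨by rw [hu 0]; simpa [hP0] using hu1lt, ?_⟩
  intro ρ ⟨hρT, hρ1⟩
  have hρ0 : 0 < ρ := lt_of_lt_of_le (by positivity) hρT
  have hw0 : ∀ x, 0 < x → 0 < 1 - κ + κ * x := fun x hx => by
    have := mul_pos hκ0 hx
    linarith
  rcases le_or_gt ((1 - κ + κ * ρ) ^ α) (β * ρ) with hle | hgt
  · refine lt_of_le_of_lt ?_ hu1pos
    have hPρ := hPpos ρ ⟨hρ0.le, hρ1.le⟩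
    have hI : ρ * P ρ ≤ ∫ x in (0 : ℝ)..ρ, P x := by
      have := intervalIntegral.integral_mono_on hρ0.le
        (intervalIntegrable_const (μ := MeasureTheory.volume) (c := P ρ))
        (hint ρ ⟨hρ0.le, hρ1.le⟩)
        (fun x hx => hanti ⟨hx.1, hx.2.trans hρ1.le⟩ ⟨hρ0.le, hρ1.le⟩ hx.2)
      simpa using this
    rw [hu]
    nlinarith [mul_le_mul_of_nonneg_left hI hβ0.le, mul_le_mul_of_nonneg_right hle hPρ.le]
  have hρ2 : 1 / 2 < ρ := by
    by_contra! h
    have h1 : 1 - κ + κ * ρ ≤ Real.exp (-(κ / 2)) := by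
      have := Real.add_one_le_exp (-(κ / 2))
      nlinarith
    have h2 : (1 - κ + κ * ρ) ^ α ≤ β / T := by
      calc (1 - κ + κ * ρ) ^ α ≤ Real.exp (-(κ / 2)) ^ α :=
            pow_le_pow_left₀ (hw0 ρ hρ0).le h1 α
        _ = Real.exp (α * -(κ / 2)) := (Real.exp_nat_mul _ _).symm
        _ ≤ Real.exp (-Real.log (T / β)) := by
            rw [div_le_iff₀ hκ0] at hα3
            gcongr
            linarith
        _ = β / T := by
            rw [Real.exp_neg, Real.exp_log (by positivity), inv_div]
    have h3 : β / T ≤ β * ρ := by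
      have := mul_le_mul_of_nonneg_left hρT hβ0.le
      rwa [mul_one_div] at this
    linarith
  have hderiv : ∀ x ∈ Set.Ioo (0 : ℝ) 1, HasDerivAt u
      ((α * (1 - κ + κ * x) ^ (α - 1) * κ) * P x + (1 - κ + κ * x) ^ α * P' x - β * P x) x := by
    intro x hx
    have hxI := Set.Ioo_subset_Icc_self hx
    have hw : HasDerivAt (fun y => (1 - κ + κ * y) ^ α)
        (α * (1 - κ + κ * x) ^ (α - 1) * κ) x := by
      have := (((hasDerivAt_id x).const_mul κ).const_add (1 - κ)).fun_pow α
      simpa using this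
    have hprim : HasDerivAt (fun y => ∫ t in (0 : ℝ)..y, P t) (P x) x :=
      intervalIntegral.integral_hasDerivAt_right (hint x hxI)
        ((hcont.mono Set.Ioo_subset_Icc_self).stronglyMeasurableAtFilter isOpen_Ioo x hx)
        (hP x hxI).continuousAt
    rw [funext hu]
    exact (hw.mul (hP x hxI)).sub (hprim.const_mul β)
  have hucont : ContinuousOn u (Set.Icc 0 1) := by
    rw [funext hu]
    refine ContinuousOn.sub (ContinuousOn.mul (by fun_prop) hcont)
      (ContinuousOn.mul continuousOn_const ?_)
    have := intervalIntegral.continuousOn_primitive_interval (f := P) (a := 0) (b := 1)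
      (μ := MeasureTheory.volume)
      (by rw [Set.uIcc_of_le zero_le_one]; exact hcont.integrableOn_Icc)
    rwa [Set.uIcc_of_le zero_le_one] at this
  have hmono : StrictMonoOn u (Set.Icc ρ 1) := by
    refine strictMonoOn_of_deriv_pos (convex_Icc ρ 1)
      (hucont.mono (Set.Icc_subset_Icc_left hρ0.le)) ?_
    intro x hx
    rw [interior_Icc] at hx
    have hx0 : 0 < x := hρ0.trans hx.1
    have hxI : x ∈ Set.Icc (0 : ℝ) 1 := ⟨hx0.le, hx.2.le⟩
    rw [(hderiv x ⟨hx0, hx.2⟩).deriv]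
    have hPx := hPpos x hxI
    have hwx := hw0 x hx0
    have hwx1 : 1 - κ + κ * x ≤ 1 := by nlinarith [hx.2]
    have hpow : (1 - κ + κ * x) ^ α ≤ (1 - κ + κ * x) ^ (α - 1) :=
      pow_le_pow_of_le_one hwx.le hwx1 (Nat.sub_le α 1)
    have hbig : β / 2 < (1 - κ + κ * x) ^ α := by
      have : (1 - κ + κ * ρ) ^ α ≤ (1 - κ + κ * x) ^ α := by
        refine pow_le_pow_left₀ (hw0 ρ hρ0).le ?_ α
        nlinarith [hx.1]
      nlinarith
    set W := (1 - κ + κ * x) ^ α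
    set V := (1 - κ + κ * x) ^ (α - 1)
    have hακ0 : 0 ≤ (α : ℝ) * κ := by positivity
    have h1 : W * (α * κ) ≤ V * (α * κ) := mul_le_mul_of_nonneg_right hpow hακ0
    have hWpos : 0 < W := by linarith
    have h2 : W * 2 ≤ W * (α * κ - lam) := by
      refine mul_le_mul_of_nonneg_left ?_ hWpos.le
      rw [mul_div_assoc] at hακ
      linarith
    have h3 : 0 < α * V * κ - W * lam - β := by linarith
    have h4 := mul_pos h3 hPx
    have h5 := mul_le_mul_of_nonneg_left (hhaz x hxI).1 hWpos.le
    linarith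
  exact hmono ⟨le_rfl, hρ1.le⟩ ⟨hρ1.le, le_rfl⟩ hρ1
end

section
/- Let T be a natural number with T ≥ 2, let κ ∈ (0,1] and β ∈ (0,1) be real numbers, and let α be a real number with α ≥ 2·ln(T/β)/κ. Then for every ρ ∈ [1/T, 1/2], (1 − κ + κρ)^α ≤ β·ρ. -/
/-- Case (ii) of the Main Theorem: for `T ≥ 2`, `κ ∈ (0,1]`,
`β ∈ (0,1)`, real `α ≥ 2·ln(T/β)/κ`, and all `ρ ∈ [1/T, 1/2]`:
`(1 − κ + κρ)^α ≤ β·ρ`. -/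
theorem middle_case_bound (T : ℕ) (hT : 2 ≤ T) (κ β α : ℝ)
    (hκ : κ ∈ Set.Ioc (0:ℝ) 1) (hβ : β ∈ Set.Ioo (0:ℝ) 1)
    (hα : 2 * Real.log ((T : ℝ) / β) / κ ≤ α) :
    ∀ ρ ∈ Set.Icc (1 / (T : ℝ)) (1/2 : ℝ), (1 - κ + κ * ρ) ^ α ≤ β * ρ := by
  obtain ⟨hκ0, hκ1⟩ := hκ
  obtain ⟨hβ0, hβ1⟩ := hβ
  rintro ρ ⟨hρT, hρ⟩
  have hT' : (2 : ℝ) ≤ T := by exact_mod_cast hT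
  have hT0 : (0 : ℝ) < T := by linarith
  have hρ0 : 0 < ρ := (one_div_pos.2 hT0).trans_le hρT
  have hlog : 0 ≤ Real.log (T / β) :=
    Real.log_nonneg ((one_le_div hβ0).2 (by linarith))
  have hα0 : 0 ≤ α := le_trans (by positivity) hα
  have hlog_le : 2 * Real.log (T / β) ≤ α * κ := (div_le_iff₀ hκ0).1 hα
  have hbase0 : 0 ≤ 1 - κ + κ * ρ := by
    have := mul_pos hκ0 hρ0
    linarith
  have hbase : 1 - κ + κ * ρ ≤ Real.exp (-(κ / 2)) := by
    have h1 := mul_le_mul_of_nonneg_left hρ hκ0.le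
    have h2 := Real.add_one_le_exp (-(κ / 2))
    linarith
  calc (1 - κ + κ * ρ) ^ α ≤ Real.exp (-(κ / 2)) ^ α :=
        Real.rpow_le_rpow hbase0 hbase hα0
    _ = Real.exp (-(κ / 2) * α) := (Real.exp_mul _ _).symm
    _ ≤ Real.exp (-Real.log (T / β)) := Real.exp_le_exp.2 (by linarith)
    _ = β * (1 / T) := by
        rw [Real.exp_neg, Real.exp_log (by positivity), inv_div, mul_one_div]
    _ ≤ β * ρ := mul_le_mul_of_nonneg_left hρT hβ0.le
end

section
/- Let κ ∈ (0,1], λ ≥ 0, β > 0 be real numbers, let α be a real number with α ≥ 2(λ+β)/(βκ), and let t be a real number with 1 − κ/2 < t < 1. Then α·β·(t + κ − 1) > λ·t^(α+1) + β·t; equivalently, t·V(t) − ακ·U(t) > 0, where V(t) = −λ·t^α + ακ·t^(α−1) − β and U(t) = t^α − (β/κ)·t + β(1−κ)/κ. -/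
/-- key algebraic inequality in Case (iii) of the Main Theorem:
for `κ ∈ (0,1]`, `λ ≥ 0`, `β > 0`, real `α ≥ 2(λ+β)/(βκ)`, and
`1 − κ/2 < t < 1`: `α·β·(t+κ−1) > λ·t^(α+1) + β·t`, equivalently
`t·V(t) − ακ·U(t) > 0`. -/
theorem tV_sub_akU_pos (κ lam β α t : ℝ)
    (hκ : κ ∈ Set.Ioc (0:ℝ) 1) (hlam : 0 ≤ lam) (hβ : 0 < β)
    (hα : 2 * (lam + β) / (β * κ) ≤ α)
    (ht : 1 - κ / 2 < t) (ht1 : t < 1) :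
    α * β * (t + κ - 1) > lam * t ^ (α + 1) + β * t ∧
    t * (-lam * t ^ α + α * κ * t ^ (α - 1) - β) -
        α * κ * (t ^ α - (β / κ) * t + β * (1 - κ) / κ) > 0 := by
  obtain ⟨hκ0, hκ1⟩ := hκ
  have ht0 : 0 < t := by linarith
  have hβκ : 0 < β * κ := mul_pos hβ hκ0
  have hα0 : 0 < α := lt_of_lt_of_le (by positivity) hα
  have hαβκ : 2 * (lam + β) ≤ α * (β * κ) := (div_le_iff₀ hβκ).mp hα
  have hpow : t ^ (α + 1) ≤ 1 := Real.rpow_le_one ht0.le ht1.le (by linarith)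
  have hmain : α * β * (t + κ - 1) > lam * t ^ (α + 1) + β * t := by
    have hleft : α * β * (κ / 2) < α * β * (t + κ - 1) :=
      mul_lt_mul_of_pos_left (by linarith) (mul_pos hα0 hβ)
    have hlam_pow : lam * t ^ (α + 1) ≤ lam := mul_le_of_le_one_right hlam hpow
    have hβt : β * t ≤ β := mul_le_of_le_one_right hβ.le ht1.le
    linarith
  refine ⟨hmain, ?_⟩
  have hsucc : t ^ (α + 1) = t ^ α * t := Real.rpow_add_one ht0.ne' α
  have hpred : t ^ (α - 1) = t ^ α / t := Real.rpow_sub_one ht0.ne' α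
  have hidentity : t * (-lam * t ^ α + α * κ * t ^ (α - 1) - β) -
      α * κ * (t ^ α - (β / κ) * t + β * (1 - κ) / κ) =
      α * β * (t + κ - 1) - (lam * t ^ (α + 1) + β * t) := by
    rw [hsucc, hpred]
    field_simp
    ring
  rw [hidentity]
  exact sub_pos.mpr hmain
end

section
/- Let γ > 0, κ ∈ (0,1], β ∈ (0,1), λ ≥ 0 be real numbers, let α be a natural number with α > β/(γκ) and α > λ/κ, and let P : ℝ → ℝ be differentiable on [0,1] with derivative P', satisfying P(ρ) > 0 and −λ·P(ρ) ≤ P'(ρ) ≤ 0 for all ρ ∈ [0,1]. Define ū_γ(ρ) = ((1+γ)·(1−κ+κρ)^α − γ)·P(ρ) − β·∫₀^ρ P(x) dx. Assume β·∫₀¹ P(x) dx < P(1). Then for every ρ ∈ [0,1), ū_γ(ρ) < ū_γ(1). -/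
open Set in
lemma hasDerivAt_integral_of_continuousOn_Icc {f : ℝ → ℝ} {a b x : ℝ}
    (hf : ContinuousOn f (Icc a b)) (hx : x ∈ Ioo a b) :
    HasDerivAt (fun t => ∫ y in a..t, f y) (f x) x := by
  have hmem : Ioo a b ∈ nhds x := isOpen_Ioo.mem_nhds hx
  have hfo : ContinuousOn f (Ioo a b) := hf.mono Ioo_subset_Icc_self
  refine intervalIntegral.integral_hasDerivAt_right ?_
    (hfo.stronglyMeasurableAtFilter isOpen_Ioo x hx) (hfo.continuousAt hmem)
  exact (hf.mono (Icc_subset_Icc_right hx.2.le)).intervalIntegrable_of_Icc hx.1.le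

/-- The lower bound on the marginal utility, with `a` the catch rate, `q` the pass probability of
a single stage, `p` the win probability and `p'` its derivative. -/
lemma marginal_utility_pos {γ β lam a q p p' : ℝ} {n : ℕ} (hγ : 0 < γ) (ha1 : β < γ * a)
    (ha2 : lam < a) (ha : 0 < a) (hq0 : 0 ≤ q) (hq1 : q ≤ 1) (hp : 0 < p)
    (hp' : -lam * p ≤ p') (hq : γ < (1 + γ) * q ^ (n + 1)) :
    0 < (1 + γ) * a * q ^ n * p + ((1 + γ) * q ^ (n + 1) - γ) * p' - β * p := by
  have hpow : q ^ (n + 1) ≤ q ^ n := pow_le_pow_of_le_one hq0 hq1 n.le_succ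
  have h1 : (1 + γ) * a * q ^ (n + 1) * p ≤ (1 + γ) * a * q ^ n * p := by gcongr
  have h2 := mul_le_mul_of_nonneg_left hp' (sub_nonneg.2 hq.le)
  have h3 : 0 < (γ * a - β) * p := mul_pos (sub_pos.2 ha1) hp
  have h4 : 0 < ((1 + γ) * q ^ (n + 1) - γ) * (a - lam) * p :=
    mul_pos (mul_pos (sub_pos.2 hq) (sub_pos.2 ha2)) hp
  linarith

/-- analytic core of the γ-IR-BIS theorem with penalty. -/
theorem penalty_theorem_core (γ κ β lam : ℝ) (hγ : 0 < γ)
    (hκ : κ ∈ Set.Ioc (0:ℝ) 1) (hβ : β ∈ Set.Ioo (0:ℝ) 1) (hlam : 0 ≤ lam)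
    (α : ℕ) (hα1 : β / (γ * κ) < (α : ℝ)) (hα2 : lam / κ < (α : ℝ))
    (P P' : ℝ → ℝ)
    (hP : ∀ ρ ∈ Set.Icc (0:ℝ) 1, HasDerivAt P (P' ρ) ρ)
    (hPpos : ∀ ρ ∈ Set.Icc (0:ℝ) 1, 0 < P ρ)
    (hhaz : ∀ ρ ∈ Set.Icc (0:ℝ) 1, -lam * P ρ ≤ P' ρ ∧ P' ρ ≤ 0)
    (u : ℝ → ℝ)
    (hu : ∀ ρ, u ρ = ((1 + γ) * (1 - κ + κ * ρ) ^ α - γ) * P ρ -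
      β * ∫ x in (0:ℝ)..ρ, P x)
    (hIR : β * ∫ x in (0:ℝ)..1, P x < P 1) :
    ∀ ρ ∈ Set.Ico (0:ℝ) 1, u ρ < u 1 := by
  obtain ⟨hκ0, hκ1⟩ := hκ
  intro ρ hρ
  have hα : 0 < (α : ℝ) := (div_pos hβ.1 (mul_pos hγ hκ0)).trans hα1
  obtain ⟨n, rfl⟩ : ∃ n, α = n + 1 :=
    Nat.exists_eq_succ_of_ne_zero (Nat.cast_pos.1 hα).ne'
  have hrate1 : β < γ * (((n + 1 : ℕ) : ℝ) * κ) := by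
    rw [div_lt_iff₀ (mul_pos hγ hκ0)] at hα1
    linarith
  have hrate2 : lam < ((n + 1 : ℕ) : ℝ) * κ := (div_lt_iff₀ hκ0).1 hα2
  have hPc : ContinuousOn P (Set.Icc 0 1) := fun x hx =>
    (hP x hx).continuousAt.continuousWithinAt
  rcases le_or_gt ((1 + γ) * (1 - κ + κ * ρ) ^ (n + 1)) γ with hle | hlt
  · have hint : 0 ≤ ∫ x in (0 : ℝ)..ρ, P x :=
      intervalIntegral.integral_nonneg hρ.1 fun x hx =>
        (hPpos x ⟨hx.1, hx.2.trans hρ.2.le⟩).le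
    have h1 := mul_nonpos_of_nonpos_of_nonneg (sub_nonpos.2 hle) (hPpos ρ ⟨hρ.1, hρ.2.le⟩).le
    have h2 := mul_nonneg hβ.1.le hint
    have h3 : u 1 = P 1 - β * ∫ x in (0 : ℝ)..1, P x := by
      rw [hu, mul_one, sub_add_cancel, one_pow]
      ring
    rw [h3, hu ρ]
    linarith
  · have hsub : Set.Icc ρ 1 ⊆ Set.Icc (0 : ℝ) 1 := Set.Icc_subset_Icc_left hρ.1
    have hcont : ContinuousOn u (Set.Icc ρ 1) := by
      have hprim : ContinuousOn (fun t => ∫ x in (0 : ℝ)..t, P x) (Set.Icc 0 1) := by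
        have h := intervalIntegral.continuousOn_primitive_interval (μ := MeasureTheory.volume)
          (f := P) (a := 0) (b := 1)
          (by rw [Set.uIcc_of_le zero_le_one]; exact hPc.integrableOn_Icc)
        rwa [Set.uIcc_of_le zero_le_one] at h
      rw [funext hu]
      refine ContinuousOn.mono ?_ hsub
      exact (ContinuousOn.mul (by fun_prop) hPc).sub (continuousOn_const.mul hprim)
    refine strictMonoOn_of_deriv_pos (convex_Icc ρ 1) hcont ?_
      (Set.left_mem_Icc.2 hρ.2.le) (Set.right_mem_Icc.2 hρ.2.le) hρ.2
    intro x hx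
    rw [interior_Icc] at hx
    have hx' : x ∈ Set.Icc (0 : ℝ) 1 := hsub (Set.Ioo_subset_Icc_self hx)
    have hderiv : HasDerivAt u ((1 + γ) * (((n + 1 : ℕ) : ℝ) * κ) * (1 - κ + κ * x) ^ n * P x +
        ((1 + γ) * (1 - κ + κ * x) ^ (n + 1) - γ) * P' x - β * P x) x := by
      have hq : HasDerivAt (fun t => 1 - κ + κ * t) κ x := by
        simpa using ((hasDerivAt_id x).const_mul κ).const_add (1 - κ)
      have hI := hasDerivAt_integral_of_continuousOn_Icc hPc ⟨hρ.1.trans_lt hx.1, hx.2⟩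
      rw [funext hu]
      refine ((((hq.pow (n + 1)).const_mul (1 + γ)).sub_const γ).mul (hP x hx')).sub
        (hI.const_mul β) |>.congr_deriv ?_
      simp only [Pi.pow_apply, Nat.add_sub_cancel]
      ring
    rw [hderiv.deriv]
    have hqρ : 0 ≤ 1 - κ + κ * ρ := add_nonneg (sub_nonneg.2 hκ1) (mul_nonneg hκ0.le hρ.1)
    have hmono : 1 - κ + κ * ρ ≤ 1 - κ + κ * x := by
      have := hx.1.le
      gcongr
    refine marginal_utility_pos hγ hrate1 hrate2 (mul_pos hα hκ0) (hqρ.trans hmono) ?_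
      (hPpos x hx') (hhaz x hx').1 (hlt.trans_le ?_)
    · linarith [mul_le_of_le_one_right hκ0.le hx'.2]
    · gcongr
end

section
/- Let γ > 0, κ ∈ (0,1], λ ≥ 0 be real numbers, β a real number, and α a natural number with α ≥ 1 and α·κ ≥ λ. Let P : ℝ → ℝ be differentiable on [0,1] (hence continuous) with derivative P', satisfying P(ρ) > 0 and −λ·P(ρ) ≤ P'(ρ) ≤ 0 for all ρ ∈ [0,1]. Define ū_γ(ρ) = ((1+γ)·(1−κ+κρ)^α − γ)·P(ρ) − β·∫₀^ρ P(x) dx. Then for every ρ ∈ (0,1) with (1+γ)·(1−κ+κρ)^α ≥ γ, the function ū_γ is differentiable at ρ and its derivative satisfies ū_γ'(ρ) ≥ (α·γ·κ − β)·P(ρ). -/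
/-- derivative lower bound in Case (i) of the penalty theorem:
above the threshold where `(1+γ)(1−κ+κρ)^α ≥ γ`, the utility bound `ū_γ` is
differentiable with derivative at least `(αγκ − β)·P(ρ)`. -/
theorem penalty_deriv_lower_bound (γ κ lam β : ℝ) (hγ : 0 < γ)
    (hκ : κ ∈ Set.Ioc (0:ℝ) 1) (hlam : 0 ≤ lam)
    (α : ℕ) (hα : 1 ≤ α) (hακ : lam ≤ (α : ℝ) * κ)
    (P P' : ℝ → ℝ)
    (hP : ∀ x ∈ Set.Icc (0:ℝ) 1, HasDerivAt P (P' x) x)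
    (hPpos : ∀ x ∈ Set.Icc (0:ℝ) 1, 0 < P x)
    (hhaz : ∀ x ∈ Set.Icc (0:ℝ) 1, -lam * P x ≤ P' x ∧ P' x ≤ 0)
    (u : ℝ → ℝ)
    (hu : ∀ x, u x = ((1 + γ) * (1 - κ + κ * x) ^ α - γ) * P x -
      β * ∫ t in (0:ℝ)..x, P t)
    (ρ : ℝ) (hρ : ρ ∈ Set.Ioo (0:ℝ) 1)
    (hth : γ ≤ (1 + γ) * (1 - κ + κ * ρ) ^ α) :
    ∃ d, HasDerivAt u d ρ ∧ ((α : ℝ) * γ * κ - β) * P ρ ≤ d := by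
  obtain ⟨hκ0, hκ1⟩ := hκ
  obtain ⟨hρ0, hρ1⟩ := hρ
  have hmem : ρ ∈ Set.Icc (0:ℝ) 1 := ⟨hρ0.le, hρ1.le⟩
  have hcont : ContinuousOn P (Set.Icc 0 1) :=
    fun x hx => (hP x hx).continuousAt.continuousWithinAt
  have hint : IntervalIntegrable P MeasureTheory.volume 0 ρ := by
    apply ContinuousOn.intervalIntegrable
    rw [Set.uIcc_of_le hρ0.le]
    exact hcont.mono (Set.Icc_subset_Icc_right hρ1.le)
  have hI : HasDerivAt (fun x => ∫ t in (0:ℝ)..x, P t) (P ρ) ρ :=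
    intervalIntegral.integral_hasDerivAt_right hint
      ((hcont.mono Set.Ioo_subset_Icc_self).stronglyMeasurableAtFilter isOpen_Ioo ρ ⟨hρ0, hρ1⟩)
      (hP ρ hmem).continuousAt
  have hlin : HasDerivAt (fun x : ℝ => 1 - κ + κ * x) κ ρ := by
    simpa using ((hasDerivAt_id ρ).const_mul κ).const_add (1 - κ)
  have hder := (((((hlin.pow α).const_mul (1 + γ)).sub_const γ).mul (hP ρ hmem)).sub
    (hI.const_mul β))
  refine ⟨_, hder.congr_of_eventuallyEq (Filter.Eventually.of_forall hu), ?_⟩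
  have hs0 : 0 ≤ 1 - κ + κ * ρ := by nlinarith
  have hs1 : 1 - κ + κ * ρ ≤ 1 := by nlinarith
  have hp := hPpos ρ hmem
  have hh := (hhaz ρ hmem).1
  simp only [Pi.pow_apply]
  set s := 1 - κ + κ * ρ
  have hpow : s ^ α ≤ s ^ (α - 1) := pow_le_pow_of_le_one hs0 hs1 (Nat.sub_le α 1)
  have h1 : (1 + γ) * (α * κ * P ρ) * s ^ α ≤ (1 + γ) * (α * κ * P ρ) * s ^ (α - 1) :=
    mul_le_mul_of_nonneg_left hpow (by positivity)
  have h2 : -(α * κ) * P ρ ≤ P' ρ :=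
    (mul_le_mul_of_nonneg_right (neg_le_neg hακ) hp.le).trans hh
  have h3 := mul_le_mul_of_nonneg_left h2 (sub_nonneg.2 hth)
  linarith
end

section
/- Let η, T, M, R₁, α, α', m be real numbers with T > 0, M > 0, 0 < η < 1/2, 0 ≤ m ≤ α', α' + 1 ≤ α, 2α ≤ ηT, and R₁ ≥ (M/T)·(2/η + 1). Set p = (ηT − m)/(T − α'). Then p > η/2 and p·(R₁ − M/T) − M/T > 0. -/
/-- core computation of the verifier incentive-security theorem:
with `p = (ηT − m)/(T − α')`, we have `p > η/2` and
`p·(R₁ − M/T) − M/T > 0`. -/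
theorem verifier_marginal_gain (η T M R₁ α α' m : ℝ)
    (hT : 0 < T) (hM : 0 < M) (hη0 : 0 < η) (hη : η < 1/2)
    (hm0 : 0 ≤ m) (hmα' : m ≤ α') (hα' : α' + 1 ≤ α) (hαη : 2 * α ≤ η * T)
    (hR : (M / T) * (2 / η + 1) ≤ R₁) :
    η / 2 < (η * T - m) / (T - α') ∧
    ((η * T - m) / (T - α')) * (R₁ - M / T) - M / T > 0 := by
  have hηT : η * T < T := by nlinarith
  have hden : 0 < T - α' := by linarith
  have hp : η / 2 < (η * T - m) / (T - α') := by
    rw [lt_div_iff₀ hden]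
    nlinarith [mul_nonneg hη0.le (hm0.trans hmα')]
  refine ⟨hp, ?_⟩
  have hc : 0 < M / T := div_pos hM hT
  have hgain : M / T * (2 / η) ≤ R₁ - M / T := by linarith
  have hpos : 0 < M / T * (2 / η) := by positivity
  have hcancel : η / 2 * (M / T * (2 / η)) = M / T := by field_simp
  have hlt : η / 2 * (M / T * (2 / η)) < (η * T - m) / (T - α') * (R₁ - M / T) :=
    mul_lt_mul hp hgain hpos ((half_pos hη0).trans hp).le
  linarith
end
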